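/- For every positive integer r there exists t₀ such that for all t ≥ t₀ there exists an r-secure frameproof code r-SFPC(v, t) with v ≤ (C(t, ⌈t/2⌉) / (2·C(t−2r, ⌈t/2⌉−r))) · (1 + ln(C(⌈t/2⌉, r)·C(⌊t/2⌋, r))). -/

import Mathlib

open Finset

/-- The envelope `F(C)`: all words agreeing with the coalition `C` on every
coordinate on which all members of `C` agree (the undetectable coordinates). -/
def envelope {v : ℕ} (C : Finset (Fin v → Bool)) : Set (Fin v → Bool) :=
  {x | ∀ i : Fin v, (∀ w₁ ∈ C, ∀ w₂ ∈ C, w₁ i = w₂ i) → ∀ w ∈ C, x i = w i}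

/-- `Γ` is an `r`-secure frameproof code of length `v` and size `t`:
a `(v, t)`-code such that the envelopes of any two disjoint (nonempty) coalitions
of size at most `r` are disjoint. -/
def IsSFPC (v t r : ℕ) (Γ : Finset (Fin v → Bool)) : Prop :=
  Γ.card = t ∧
    ∀ C₁ C₂ : Finset (Fin v → Bool), C₁ ⊆ Γ → C₂ ⊆ Γ →
      C₁.Nonempty → C₂.Nonempty → C₁.card ≤ r → C₂.card ≤ r → Disjoint C₁ C₂ →
      envelope C₁ ∩ envelope C₂ = ∅

theorem harmonic_add_div_le {a b m : ℕ} (hm : a + b ≤ m) :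
    harmonic a + (b : ℚ) / m ≤ harmonic (a + b) := by
  induction b with
  | zero => simp
  | succ b ih =>
    have hb := ih (by omega)
    have hinv : (1 : ℚ) / m ≤ (↑(a + b + 1))⁻¹ := by
      rw [one_div]
      exact inv_anti₀ (by positivity) (by exact_mod_cast hm)
    rw [← add_assoc, harmonic_succ, Nat.cast_succ, add_div]
    linarith

/-- Greedy covering: if every point of `U` lies in at least `k` of the sets `f i` with `i ∈ s`, then
`U` is covered by a subfamily whose size, multiplied by `k`, is at most the sum of the harmonic
numbers of the sizes of the traces on `U`. -/
theorem exists_cover_card_mul_le_sum_harmonic {ι X : Type*} [DecidableEq ι] [DecidableEq X]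
    (s : Finset ι) (f : ι → Finset X) {k : ℕ} (hk : 0 < k) (U : Finset X)
    (hU : ∀ x ∈ U, k ≤ #{i ∈ s | x ∈ f i}) :
    ∃ T : Finset ι, (∀ x ∈ U, ∃ i ∈ T, x ∈ f i) ∧
      (#T : ℚ) * k ≤ ∑ i ∈ s, harmonic #(f i ∩ U) := by
  induction U using Finset.strongInduction with
  | H U ih =>
  rcases U.eq_empty_or_nonempty with rfl | ⟨x₀, hx₀⟩
  · exact ⟨∅, by simp⟩
  obtain ⟨j, hj⟩ := Finset.card_pos.mp (hk.trans_le (hU x₀ hx₀))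
  rw [mem_filter] at hj
  obtain ⟨i₀, -, hmax⟩ := Finset.exists_max_image s (fun i => #(f i ∩ U)) ⟨j, hj.1⟩
  have hm : 0 < #(f i₀ ∩ U) :=
    (Finset.card_pos.mpr ⟨x₀, mem_inter.mpr ⟨hj.2, hx₀⟩⟩).trans_le (hmax j hj.1)
  obtain ⟨x₁, hx₁⟩ := Finset.card_pos.mp hm
  rw [mem_inter] at hx₁
  obtain ⟨T, hT, hcard⟩ := ih (U \ f i₀)
    (Finset.ssubset_iff_subset_ne.mpr ⟨sdiff_subset, fun h =>
      (mem_sdiff.mp (h.symm ▸ hx₁.2)).2 hx₁.1⟩)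
    (fun x hx => hU x (mem_sdiff.mp hx).1)
  refine ⟨insert i₀ T, fun x hx => ?_, ?_⟩
  · by_cases h : x ∈ f i₀
    · exact ⟨i₀, mem_insert_self _ _, h⟩
    · obtain ⟨i, hi, hxi⟩ := hT x (mem_sdiff.mpr ⟨hx, h⟩)
      exact ⟨i, mem_insert_of_mem hi, hxi⟩
  have hsplit (i : ι) : #(f i ∩ U) = #(f i ∩ (U \ f i₀)) + #{x ∈ f i₀ ∩ U | x ∈ f i} := by
    rw [← Finset.card_union_of_disjoint]
    · congr 1; ext x; simp; tauto
    · rw [Finset.disjoint_left]; intro x; simp; tauto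
  have hdouble : k * #(f i₀ ∩ U) ≤ ∑ i ∈ s, #{x ∈ f i₀ ∩ U | x ∈ f i} := by
    have := Finset.sum_card_bipartiteAbove_eq_sum_card_bipartiteBelow
      (s := s) (t := f i₀ ∩ U) (fun i x => x ∈ f i)
    simp only [bipartiteAbove, bipartiteBelow] at this
    rw [this, mul_comm, ← smul_eq_mul]
    exact Finset.card_nsmul_le_sum _ _ _ fun x hx => hU x (mem_inter.mp hx).2
  have hgain : ∀ i ∈ s, harmonic #(f i ∩ (U \ f i₀)) +
      (#{x ∈ f i₀ ∩ U | x ∈ f i} : ℚ) / #(f i₀ ∩ U) ≤ harmonic #(f i ∩ U) := by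
    intro i hi
    have hle := hmax i hi
    rw [hsplit i] at hle ⊢
    exact harmonic_add_div_le hle
  have hsum := Finset.sum_le_sum hgain
  rw [Finset.sum_add_distrib, ← Finset.sum_div] at hsum
  have hk' : (k : ℚ) ≤ (∑ i ∈ s, (#{x ∈ f i₀ ∩ U | x ∈ f i} : ℚ)) / #(f i₀ ∩ U) := by
    rw [le_div_iff₀ (by exact_mod_cast hm)]
    exact_mod_cast hdouble
  have hins : (#(insert i₀ T) : ℚ) ≤ #T + 1 := by exact_mod_cast card_insert_le i₀ T
  have := mul_le_mul_of_nonneg_right hins (Nat.cast_nonneg (α := ℚ) k)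
  linarith

/-- If `A` and `B` are disjoint, at least `(|α| - (|A| + |B|)).choose (n - |A|)` sets of size `n`
contain `A` and avoid `B`. -/
theorem choose_le_card_separating {α : Type*} [Fintype α] [DecidableEq α] {A B : Finset α} {n : ℕ}
    (hAB : Disjoint A B) (hn : #A ≤ n) :
    (Fintype.card α - (#A + #B)).choose (n - #A) ≤
      #{S ∈ powersetCard n (univ : Finset α) | A ⊆ S ∧ Disjoint B S} := by
  rw [← card_union_of_disjoint hAB, ← card_compl, ← card_powersetCard]
  have hdisj {P : Finset α} (hP : P ∈ powersetCard (n - #A) (A ∪ B)ᶜ) : Disjoint (A ∪ B) P :=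
    (Finset.subset_compl_iff_disjoint_left.mp (mem_powersetCard.mp hP).1)
  refine Finset.card_le_card_of_injOn (fun P => P ∪ A) ?_ ?_
  · intro P hP
    have hd := Finset.disjoint_union_left.mp (hdisj hP)
    have hc := (mem_powersetCard.mp hP).2
    simp only [mem_coe, mem_filter, mem_powersetCard, subset_univ, true_and, subset_union_right,
      disjoint_union_right]
    refine ⟨?_, hd.2, hAB.symm⟩
    rw [card_union_of_disjoint hd.1.symm, hc]
    omega
  · intro P hP Q hQ h
    have hP' := (Finset.disjoint_union_left.mp (hdisj hP)).1
    have hQ' := (Finset.disjoint_union_left.mp (hdisj hQ)).1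
    have := congrArg (· \ A) h
    simpa [union_sdiff_right, sdiff_eq_self_of_disjoint hP'.symm,
      sdiff_eq_self_of_disjoint hQ'.symm] using this

/-- Two disjoint sets of size at most `r` extend to disjoint sets of size exactly `r`. -/
theorem exists_disjoint_superset_card_eq {α : Type*} [Fintype α] [DecidableEq α]
    {A B : Finset α} {r : ℕ} (hr : 2 * r ≤ Fintype.card α) (hAB : Disjoint A B)
    (hA : #A ≤ r) (hB : #B ≤ r) :
    ∃ A' B' : Finset α, A ⊆ A' ∧ B ⊆ B' ∧ Disjoint A' B' ∧ #A' = r ∧ #B' = r := by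
  obtain ⟨A', hAA', hA'B, hA'⟩ := exists_subsuperset_card_eq
    (Finset.subset_compl_iff_disjoint_right.mpr hAB) hA (by rw [card_compl]; omega)
  obtain ⟨B', hBB', hB'A, hB'⟩ := exists_subsuperset_card_eq
    (Finset.subset_compl_iff_disjoint_left.mpr
      (Finset.subset_compl_iff_disjoint_right.mp hA'B)) hB (by rw [card_compl]; omega)
  exact ⟨A', B', hAA', hBB', Finset.subset_compl_iff_disjoint_left.mp hB'A, hA', hB'⟩

theorem exists_separating_family {r t : ℕ} (hr : 0 < r) (ht : 2 * r ≤ t) :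
    ∃ T : Finset (Finset (Fin t)),
      (#T : ℝ) ≤ (Nat.choose t ((t + 1) / 2) : ℝ) /
            (2 * (Nat.choose (t - 2 * r) ((t + 1) / 2 - r) : ℝ)) *
            (1 + Real.log ((Nat.choose ((t + 1) / 2) r : ℝ) * (Nat.choose (t / 2) r : ℝ))) ∧
      ∀ A B : Finset (Fin t), Disjoint A B → #A ≤ r → #B ≤ r →
        ∃ S ∈ T, (A ⊆ S ∧ Disjoint B S) ∨ (B ⊆ S ∧ Disjoint A S) := by
  set n := (t + 1) / 2 with hn
  set c := (t - 2 * r).choose (n - r) with hc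
  set d := n.choose r * (t / 2).choose r with hd
  have hcpos : 0 < c := Nat.choose_pos (by omega)
  have hdpos : 0 < d := Nat.mul_pos (Nat.choose_pos (by omega)) (Nat.choose_pos (by omega))
  let f : Finset (Fin t) → Finset (Sym2 (Finset (Fin t))) := fun S =>
    (powersetCard r S ×ˢ powersetCard r Sᶜ).image fun p => s(p.1, p.2)
  let U : Finset (Sym2 (Finset (Fin t))) :=
    ({p : Finset (Fin t) × Finset (Fin t) | Disjoint p.1 p.2 ∧ #p.1 = r ∧ #p.2 = r} : Finset _).image
      fun p => s(p.1, p.2)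
  have hmem {A B S : Finset (Fin t)} (hA : #A = r) (hB : #B = r) :
      s(A, B) ∈ f S ↔ (A ⊆ S ∧ Disjoint B S) ∨ (B ⊆ S ∧ Disjoint A S) := by
    simp only [f, mem_image, mem_product, mem_powersetCard, Prod.exists, Sym2.eq_iff,
      Finset.subset_compl_iff_disjoint_right]
    constructor
    · rintro ⟨P, Q, ⟨hP, hQ⟩, ⟨rfl, rfl⟩ | ⟨rfl, rfl⟩⟩
      · exact Or.inl ⟨hP.1, hQ.1⟩
      · exact Or.inr ⟨hP.1, hQ.1⟩
    · rintro (h | h)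
      · exact ⟨A, B, ⟨⟨h.1, hA⟩, h.2, hB⟩, Or.inl ⟨rfl, rfl⟩⟩
      · exact ⟨B, A, ⟨⟨h.1, hB⟩, h.2, hA⟩, Or.inr ⟨rfl, rfl⟩⟩
  have hdeg : ∀ x ∈ U, 2 * c ≤ #{S ∈ powersetCard n (univ : Finset (Fin t)) | x ∈ f S} := by
    intro x hx
    simp only [U, mem_image, mem_filter, mem_univ, true_and, Prod.exists] at hx
    obtain ⟨A, B, ⟨hAB, hA, hB⟩, rfl⟩ := hx
    simp only [hmem hA hB]
    rw [filter_or, card_union_of_disjoint, two_mul]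
    · have h₁ := choose_le_card_separating (n := n) hAB (by omega)
      have h₂ := choose_le_card_separating (n := n) hAB.symm (by omega)
      rw [hA, hB, Fintype.card_fin, ← two_mul] at h₁ h₂
      exact Nat.add_le_add h₁ h₂
    · rw [Finset.disjoint_left]
      rintro S hS hS'
      simp only [mem_filter] at hS hS'
      have hAe := hS'.2.2.eq_bot_of_le hS.2.1
      rw [hAe] at hA
      simp at hA
      omega
  have hsize : ∀ S ∈ powersetCard n (univ : Finset (Fin t)), #(f S ∩ U) ≤ d := by
    intro S hS
    have hS := (mem_powersetCard.mp hS).2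
    refine (card_le_card inter_subset_left).trans (card_image_le.trans ?_)
    rw [card_product, card_powersetCard, card_powersetCard, card_compl, hS, Fintype.card_fin,
      show t - n = t / 2 by omega]
  obtain ⟨T, hT, hcard⟩ := exists_cover_card_mul_le_sum_harmonic
    (powersetCard n (univ : Finset (Fin t))) f (by omega : 0 < 2 * c) U hdeg
  refine ⟨T, ?_, fun A B hAB hA hB => ?_⟩
  · have hbound : ∀ S ∈ powersetCard n (univ : Finset (Fin t)),
        ((harmonic #(f S ∩ U) : ℚ) : ℝ) ≤ 1 + Real.log d := by
      intro S hS
      have hmono : harmonic #(f S ∩ U) ≤ harmonic d :=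
        Finset.sum_le_sum_of_subset_of_nonneg (range_subset_range.mpr (hsize S hS))
          fun i _ _ => by positivity
      exact (Rat.cast_le.mpr hmono).trans (harmonic_le_one_add_log d)
    have hsum := Finset.sum_le_card_nsmul _ _ _ hbound
    rw [card_powersetCard, card_univ, Fintype.card_fin, nsmul_eq_mul] at hsum
    have hcard' : (#T : ℝ) * (2 * c) ≤ ∑ S ∈ powersetCard n (univ : Finset (Fin t)),
        ((harmonic #(f S ∩ U) : ℚ) : ℝ) := by exact_mod_cast hcard
    rw [← Nat.cast_mul, ← hd, div_mul_eq_mul_div, le_div_iff₀ (by positivity)]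
    exact hcard'.trans hsum
  · obtain ⟨A', B', hAA', hBB', hAB', hA', hB'⟩ :=
      exists_disjoint_superset_card_eq (by simpa using ht) hAB hA hB
    obtain ⟨S, hS, hx⟩ := hT s(A', B')
      (mem_image.mpr ⟨(A', B'), by simp [hAB', hA', hB'], rfl⟩)
    refine ⟨S, hS, ((hmem hA' hB').mp hx).imp ?_ ?_⟩
    · exact fun h => ⟨hAA'.trans h.1, h.2.mono_left hBB'⟩
    · exact fun h => ⟨hBB'.trans h.1, h.2.mono_left hAA'⟩

theorem envelope_inter_eq_empty {v : ℕ} {C₁ C₂ : Finset (Fin v → Bool)} (h₁ : C₁.Nonempty)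
    (h₂ : C₂.Nonempty) {i : Fin v} {b : Bool} (hb₁ : ∀ w ∈ C₁, w i = b)
    (hb₂ : ∀ w ∈ C₂, w i = !b) : envelope C₁ ∩ envelope C₂ = ∅ := by
  obtain ⟨w₁, hw₁⟩ := h₁
  obtain ⟨w₂, hw₂⟩ := h₂
  refine Set.eq_empty_iff_forall_notMem.mpr fun x ⟨hx₁, hx₂⟩ => ?_
  have e₁ := hx₁ i (fun u hu w hw => (hb₁ u hu).trans (hb₁ w hw).symm) w₁ hw₁
  have e₂ := hx₂ i (fun u hu w hw => (hb₂ u hu).trans (hb₂ w hw).symm) w₂ hw₂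
  rw [hb₁ w₁ hw₁] at e₁
  rw [hb₂ w₂ hw₂, e₁] at e₂
  cases b <;> simp at e₂

/-- The incidence vectors of a separating family form a secure frameproof code. -/
theorem exists_isSFPC_of_separating {r t : ℕ} (hr : 0 < r) (T : Finset (Finset (Fin t)))
    (hT : ∀ A B : Finset (Fin t), Disjoint A B → #A ≤ r → #B ≤ r →
      ∃ S ∈ T, (A ⊆ S ∧ Disjoint B S) ∨ (B ⊆ S ∧ Disjoint A S)) :
    ∃ Γ : Finset (Fin #T → Bool), IsSFPC #T t r Γ := by
  let word : Fin t → Fin #T → Bool := fun a i => decide (a ∈ (T.equivFin.symm i).1)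
  have hword {S : Finset (Fin t)} (hS : S ∈ T) (a : Fin t) :
      word a (T.equivFin ⟨S, hS⟩) = decide (a ∈ S) := by simp [word]
  have hinj : Function.Injective word := by
    intro a b hab
    by_contra hne
    obtain ⟨S, hS, h⟩ := hT {a} {b} (by simpa using hne) hr hr
    have := congrFun hab (T.equivFin ⟨S, hS⟩)
    rw [hword hS, hword hS, decide_eq_decide] at this
    simp only [singleton_subset_iff, disjoint_singleton_left] at h
    tauto
  refine ⟨univ.image word, by simp [card_image_of_injective _ hinj], ?_⟩
  intro C₁ C₂ h₁ h₂ hne₁ hne₂ hc₁ hc₂ hdisj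
  obtain ⟨A, -, rfl⟩ := subset_image_iff.mp h₁
  obtain ⟨B, -, rfl⟩ := subset_image_iff.mp h₂
  rw [card_image_of_injective _ hinj] at hc₁ hc₂
  rw [disjoint_image hinj] at hdisj
  obtain ⟨S, hS, ⟨hA, hB⟩ | ⟨hB, hA⟩⟩ := hT A B hdisj hc₁ hc₂
  · refine envelope_inter_eq_empty hne₁ hne₂ (i := T.equivFin ⟨S, hS⟩) (b := true) ?_ ?_
    · simpa [forall_mem_image, hword hS] using fun a ha => hA ha
    · simpa [forall_mem_image, hword hS] using fun a ha => disjoint_left.mp hB ha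
  · refine envelope_inter_eq_empty hne₁ hne₂ (i := T.equivFin ⟨S, hS⟩) (b := false) ?_ ?_
    · simpa [forall_mem_image, hword hS] using fun a ha => disjoint_left.mp hA ha
    · simpa [forall_mem_image, hword hS] using fun a ha => hB ha

/-- For every positive integer `r` there exists `t₀` such that for
all `t ≥ t₀` there is an `r`-SFPC(v, t) with
`v ≤ (C(t,⌈t/2⌉) / (2·C(t−2r,⌈t/2⌉−r))) · (1 + ln(C(⌈t/2⌉,r)·C(⌊t/2⌋,r)))`. -/
theorem exists_sfpc_of_large (r : ℕ) (hr : 0 < r) :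
    ∃ t₀ : ℕ, ∀ t : ℕ, t₀ ≤ t →
      ∃ v : ℕ,
        (v : ℝ) ≤ (Nat.choose t ((t + 1) / 2) : ℝ) /
            (2 * (Nat.choose (t - 2 * r) ((t + 1) / 2 - r) : ℝ)) *
            (1 + Real.log ((Nat.choose ((t + 1) / 2) r : ℝ) * (Nat.choose (t / 2) r : ℝ))) ∧
        ∃ Γ : Finset (Fin v → Bool), IsSFPC v t r Γ := by
  refine ⟨2 * r, fun t ht => ?_⟩
  obtain ⟨T, hcard, hT⟩ := exists_separating_family hr ht
  exact ⟨#T, hcard, exists_isSFPC_of_separating hr T hT⟩
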